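/- arXiv:2312.00056 — 2 statements merged into one kernel-verified Lean document; each statement's English description precedes it below -/
import Mathlib

section
/- Let K be a field of characteristic 0, R = K[p₁, p₂, p₃, …] the polynomial ring in countably many variables, p_i^* = i·∂/∂p_i for i ≥ 1, t a central formal variable, k ≥ 1 an integer and u₁, …, u_k ∈ K. Suppose given K-linear operators A_i(s) on R (i ≥ 1, 0 ≤ s ≤ k) and K-linear operators D_{ij,l}(s) on R (i, j, l ≥ 1, 0 ≤ s ≤ k), with all displayed sums over l locally finite, satisfying for all i, j ≥ 1 and all 0 ≤ s, s' ≤ k: (1) [p_i^*, A_j(s)] − [p_j^*, A_i(s)] = Σ_{l≥1} D_{ij,l}(s) ∘ p_l^*; (2) [A_i(s), A_j(s)] = Σ_{l≥1} D_{ij,l}(s) ∘ A_l(s); (3) [A_i(s), A_j(s')] − [A_j(s), A_i(s')] = Σ_{l≥1} ( D_{ij,l}(s') ∘ A_l(s) + D_{ij,l}(s) ∘ A_l(s') ). Define, in the ring End_K(R)[t] of polynomials in t with operator coefficients, L_i := −p_i^* + t · Σ_{s=0}^{k} e_{k−s}(u₁, …, u_k) · A_i(s), where e_r is the r-th elementary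 symmetric polynomial (e₀ = 1). Then for all i, j ≥ 1: [L_i, L_j] = t · Σ_{l≥1} D^{(k)}_{ij,l} ∘ L_l, where D^{(k)}_{ij,l} = Σ_{s=0}^{k} e_{k−s}(u₁, …, u_k) · D_{ij,l}(s). -/
noncomputable section

/-- The polynomial ring `K[p₁, p₂, …]`, with one variable `p_i` for each positive integer. -/
abbrev Rp (K : Type) [Field K] : Type := MvPolynomial ℕ+ K

/-- The partial derivative `∂/∂p_i` as a `K`-linear endomorphism (junk value `0` for `i = 0`). -/
def pderivN (K : Type) [Field K] (i : ℕ) : Module.End K (Rp K) :=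
  if h : 0 < i then (MvPolynomial.pderiv (⟨i, h⟩ : ℕ+)).toLinearMap else 0

/-- The operator `p_i^* = i·∂/∂p_i`. -/
def pstar (K : Type) [Field K] (i : ℕ) : Module.End K (Rp K) :=
  (i : K) • pderivN K i

/-- A linear operator on `R` acting coefficientwise on elements of `R[t]` (and `R[[t]]`),
the latter being encoded by their coefficient sequences `ℕ → R`. -/
def liftE (K : Type) [Field K] (φ : Module.End K (Rp K)) : Module.End K (ℕ → Rp K) where
  toFun := fun F n => φ (F n)
  map_add' := fun F G => by funext n; simp
  map_smul' := fun c F => by funext n; simp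

/-- Multiplication by the central variable `t`, i.e. the coefficient shift. -/
def tshift (K : Type) [Field K] : Module.End K (ℕ → Rp K) where
  toFun := fun F n => if n = 0 then 0 else F (n - 1)
  map_add' := fun F G => by funext n; by_cases h : n = 0 <;> simp [h]
  map_smul' := fun c F => by funext n; by_cases h : n = 0 <;> simp [h]

/-- The elementary symmetric polynomial `e_r(u₁, …, u_k)` (with `e₀ = 1`). -/
def esymK (K : Type) [Field K] (k : ℕ) (u : Fin k → K) (r : ℕ) : K :=
  ∑ T ∈ Finset.powersetCard r (Finset.univ : Finset (Fin k)), ∏ i ∈ T, u i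

/-- The operator `L_i = −p_i^* + t · Σ_{s=0}^{k} e_{k−s}(u₁, …, u_k) · A_i(s)`, an element of
`End_K(R)[t]` realized faithfully by its action on coefficient sequences, the central variable
`t` acting as the shift `tshift`. -/
def Lgen (K : Type) [Field K] (k : ℕ) (u : Fin k → K)
    (A : ℕ → ℕ → Module.End K (Rp K)) (i : ℕ) : Module.End K (ℕ → Rp K) :=
  liftE K (-pstar K i) +
    tshift K * liftE K (∑ s ∈ Finset.range (k + 1), esymK K k u (k - s) • A i s)

/-- The family `f` has finite support on `s`, and its sum over `s` is `x`. -/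
def FinSumsTo {ι M : Type*} [AddCommMonoid M] (s : Set ι) (f : ι → M) (x : M) : Prop :=
  (s ∩ Function.support f).Finite ∧ ∑ᶠ l ∈ s, f l = x

namespace FinSumsTo

variable {ι κ M N : Type*} [AddCommMonoid M] [AddCommMonoid N] {s : Set ι}

lemma zero : FinSumsTo s (fun _ : ι => (0 : M)) 0 :=
  ⟨by simp, by simp⟩

lemma add {f g : ι → M} {x y : M} (hf : FinSumsTo s f x) (hg : FinSumsTo s g y) :
    FinSumsTo s (fun l => f l + g l) (x + y) := by
  refine ⟨(hf.1.union hg.1).subset ?_, ?_⟩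
  · rw [← Set.inter_union_distrib_left]
    exact Set.inter_subset_inter_right _ (Function.support_add f g)
  · rw [finsum_mem_add_distrib' hf.1 hg.1, hf.2, hg.2]

lemma map {f : ι → M} {x : M} (hf : FinSumsTo s f x) (φ : M →+ N) :
    FinSumsTo s (fun l => φ (f l)) (φ x) := by
  refine ⟨hf.1.subset (Set.inter_subset_inter_right _ ?_), ?_⟩
  · exact Function.support_comp_subset φ.map_zero f
  · rw [← hf.2, φ.map_finsum_mem' hf.1]

lemma sum (T : Finset κ) {f : κ → ι → M} {x : κ → M}
    (h : ∀ a ∈ T, FinSumsTo s (f a) (x a)) :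
    FinSumsTo s (fun l => ∑ a ∈ T, f a l) (∑ a ∈ T, x a) := by
  classical
  induction T using Finset.induction_on with
  | empty => simpa using zero
  | insert a T ha ih =>
    simp only [Finset.sum_insert ha]
    exact (h a (Finset.mem_insert_self a T)).add
      (ih fun b hb => h b (Finset.mem_insert_of_mem hb))

lemma smul {K V : Type*} [Semiring K] [AddCommMonoid V] [Module K V] {f : ι → V} {x : V}
    (hf : FinSumsTo s f x) (c : K) : FinSumsTo s (fun l => c • f l) (c • x) :=
  hf.map (DistribSMul.toAddMonoidHom V c)

lemma pi (T : Finset κ) {f : ι → κ → M} {x : κ → M}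
    (hT : ∀ n ∉ T, (∀ l, f l n = 0) ∧ x n = 0)
    (h : ∀ n, FinSumsTo s (fun l => f l n) (x n)) : FinSumsTo s f x := by
  classical
  have expand : ∀ y : κ → M, (∀ n ∉ T, y n = 0) → ∑ n ∈ T, Pi.single n (y n) = y := by
    intro y hy
    funext m
    rw [Finset.sum_apply, Finset.sum_pi_single]
    split_ifs with hm
    · rfl
    · exact (hy m hm).symm
  have key := sum T fun n _ => (h n).map (AddMonoidHom.single (fun _ : κ => M) n)
  simp only [AddMonoidHom.single_apply] at key
  rw [expand x fun n hn => (hT n hn).2] at key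
  rwa [funext fun l => expand (f l) fun n hn => (hT n hn).1 l] at key

end FinSumsTo

section Weighted

variable {K V ι κ : Type*} [Field K] [AddCommGroup V] [Module K V] {S : Set ι}

lemma finSumsTo_weighted_comp (T : Finset κ) (e : κ → K) (P : ι → Module.End K V)
    (p q : Module.End K V) (a b : κ → Module.End K V) (D : ι → κ → Module.End K V) (f : V)
    (h : ∀ s ∈ T, FinSumsTo S (fun l => D l s (P l f)) ((⁅p, b s⁆ - ⁅q, a s⁆) f)) :
    FinSumsTo S (fun l => (∑ s ∈ T, e s • D l s) (P l f))
      ((⁅p, ∑ s ∈ T, e s • b s⁆ - ⁅q, ∑ s ∈ T, e s • a s⁆) f) := by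
  convert FinSumsTo.sum T fun s hs => (h s hs).smul (e s) using 1
  · funext l
    simp [LinearMap.sum_apply]
  · simp [LinearMap.sum_apply, Ring.lie_def, smul_sub, Finset.sum_sub_distrib]

lemma finSumsTo_weighted_comp_weighted [CharZero K] (T : Finset κ) (e : κ → K)
    (A : ι → κ → Module.End K V) (a b : κ → Module.End K V) (D : ι → κ → Module.End K V) (f : V)
    (h : ∀ s ∈ T, ∀ r ∈ T, FinSumsTo S (fun l => D l r (A l s f) + D l s (A l r f))
      ((⁅a s, b r⁆ - ⁅b s, a r⁆) f)) :
    FinSumsTo S (fun l => (∑ s ∈ T, e s • D l s) ((∑ s ∈ T, e s • A l s) f))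
      (⁅∑ s ∈ T, e s • a s, ∑ s ∈ T, e s • b s⁆ f) := by
  have expand : ∀ x y : κ → Module.End K V, (∑ s ∈ T, e s • x s) ((∑ s ∈ T, e s • y s) f) =
      ∑ s ∈ T, ∑ r ∈ T, (e s * e r) • x r (y s f) := by
    intro x y
    simp [LinearMap.sum_apply, Finset.smul_sum, smul_smul]
  have expand' : ∀ x y : κ → Module.End K V, (∑ s ∈ T, e s • x s) ((∑ s ∈ T, e s • y s) f) =
      ∑ s ∈ T, ∑ r ∈ T, (e s * e r) • x s (y r f) := by
    intro x y
    rw [expand, Finset.sum_comm]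
    simp only [mul_comm]
  have half : ∀ v : V, (2⁻¹ : K) • (v + v) = v := by
    intro v
    rw [← two_smul K v, smul_smul, inv_mul_cancel₀ two_ne_zero, one_smul]
  convert (FinSumsTo.sum T fun s hs => FinSumsTo.sum T fun r hr =>
    (h s hs r hr).smul (e s * e r)).smul (2⁻¹ : K) using 1
  · funext l
    simp only [smul_add, Finset.sum_add_distrib]
    rw [← expand, ← expand', ← smul_add, half]
  · simp only [Ring.lie_def, LinearMap.sub_apply, Module.End.mul_apply, smul_sub,
      Finset.sum_sub_distrib]
    simp only [← expand, ← expand', ← smul_sub]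
    rw [sub_eq_add_neg (_ - _) (_ - _), neg_sub, half]

end Weighted

lemma MvPolynomial.pderiv_comm {σ R : Type*} [CommRing R] (i j : σ) (f : MvPolynomial σ R) :
    pderiv i (pderiv j f) = pderiv j (pderiv i f) := by
  classical
  have h : ⁅pderiv (R := R) i, pderiv j⁆ = (0 : Derivation R (MvPolynomial σ R) _) := by
    refine derivation_ext fun m => ?_
    rw [Derivation.commutator_apply, Derivation.zero_apply, pderiv_X, pderiv_X]
    simp [Pi.single_apply, apply_ite]
  have h' := DFunLike.congr_fun h f
  rwa [Derivation.commutator_apply, Derivation.zero_apply, sub_eq_zero] at h'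

lemma pstar_apply_of_pos (K : Type) [Field K] {i : ℕ} (hi : 0 < i) (f : Rp K) :
    pstar K i f = (i : K) • MvPolynomial.pderiv (i.toPNat hi) f := by
  have h : pderivN K i = (MvPolynomial.pderiv (R := K) (i.toPNat hi)).toLinearMap := dif_pos hi
  rw [pstar, h]
  rfl

lemma pstar_comm (K : Type) [Field K] (i j : ℕ) (f : Rp K) :
    pstar K i (pstar K j f) = pstar K j (pstar K i f) := by
  by_cases hi : 0 < i
  · by_cases hj : 0 < j
    · simp only [pstar_apply_of_pos K hi, pstar_apply_of_pos K hj, Derivation.map_smul]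
      rw [smul_comm, MvPolynomial.pderiv_comm]
    · simp [pstar, pderivN, hj]
  · simp [pstar, pderivN, hi]

lemma liftE_apply (K : Type) [Field K] (φ : Module.End K (Rp K)) (F : ℕ → Rp K) (n : ℕ) :
    liftE K φ F n = φ (F n) := rfl

lemma tshift_apply_zero (K : Type) [Field K] (F : ℕ → Rp K) : tshift K F 0 = 0 := rfl

lemma tshift_apply_succ (K : Type) [Field K] (F : ℕ → Rp K) (n : ℕ) :
    tshift K F (n + 1) = F n := rfl

lemma tshift_liftE (K : Type) [Field K] (φ : Module.End K (Rp K)) (F : ℕ → Rp K) :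
    tshift K (liftE K φ F) = liftE K φ (tshift K F) := by
  funext n
  cases n <;> simp [liftE_apply, tshift_apply_zero, tshift_apply_succ]

/--
**Assembly of the constraint algebra of `b`-deformed `k`-constellations.**
Let `K` be a field of characteristic `0`, `R = K[p₁, p₂, …]`, `p_i^* = i·∂/∂p_i`, `k ≥ 1` and
`u₁, …, u_k ∈ K`.  Suppose given operators `A_i(s)` and `D_{ij,l}(s)` on `R`
(`i, j, l ≥ 1`, `0 ≤ s, s' ≤ k`), with all displayed sums over `l` locally finite, satisfying
(1) `[p_i^*, A_j(s)] − [p_j^*, A_i(s)] = Σ_{l≥1} D_{ij,l}(s) ∘ p_l^*`;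
(2) `[A_i(s), A_j(s)] = Σ_{l≥1} D_{ij,l}(s) ∘ A_l(s)`;
(3) `[A_i(s), A_j(s')] − [A_j(s), A_i(s')] = Σ_{l≥1} (D_{ij,l}(s') ∘ A_l(s) + D_{ij,l}(s) ∘ A_l(s'))`.
Then the operators `L_i := −p_i^* + t·Σ_{s=0}^k e_{k−s}(u₁,…,u_k)·A_i(s)` in `End_K(R)[t]`
satisfy, for all `i, j ≥ 1`,
`[L_i, L_j] = t · Σ_{l≥1} D^{(k)}_{ij,l} ∘ L_l` with
`D^{(k)}_{ij,l} = Σ_{s=0}^k e_{k−s}(u₁,…,u_k)·D_{ij,l}(s)`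
(a locally finite sum); the identity in `End_K(R)[t]` is expressed by evaluating both sides on
every polynomial coefficient sequence `F` (i.e. on every element of `R[t]`).
-/
theorem stmt_8 {K : Type} [Field K] [CharZero K] (k : ℕ) (hk : 1 ≤ k) (u : Fin k → K)
    (A : ℕ → ℕ → Module.End K (Rp K)) (D : ℕ → ℕ → ℕ → ℕ → Module.End K (Rp K))
    (h1 : ∀ i j : ℕ, 1 ≤ i → 1 ≤ j → ∀ s : ℕ, s ≤ k → ∀ f : Rp K,
      (⁅pstar K i, A j s⁆ - ⁅pstar K j, A i s⁆) f =
        ∑ᶠ l ∈ Set.Ici (1 : ℕ), (D i j l s) ((pstar K l) f))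
    (h1fin : ∀ i j : ℕ, 1 ≤ i → 1 ≤ j → ∀ s : ℕ, s ≤ k → ∀ f : Rp K,
      (Set.Ici 1 ∩ Function.support fun l : ℕ => (D i j l s) ((pstar K l) f)).Finite)
    (h2 : ∀ i j : ℕ, 1 ≤ i → 1 ≤ j → ∀ s : ℕ, s ≤ k → ∀ f : Rp K,
      ⁅A i s, A j s⁆ f = ∑ᶠ l ∈ Set.Ici (1 : ℕ), (D i j l s) ((A l s) f))
    (h2fin : ∀ i j : ℕ, 1 ≤ i → 1 ≤ j → ∀ s : ℕ, s ≤ k → ∀ f : Rp K,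
      (Set.Ici 1 ∩ Function.support fun l : ℕ => (D i j l s) ((A l s) f)).Finite)
    (h3 : ∀ i j : ℕ, 1 ≤ i → 1 ≤ j → ∀ s : ℕ, s ≤ k → ∀ s' : ℕ, s' ≤ k → ∀ f : Rp K,
      (⁅A i s, A j s'⁆ - ⁅A j s, A i s'⁆) f =
        ∑ᶠ l ∈ Set.Ici (1 : ℕ), ((D i j l s') ((A l s) f) + (D i j l s) ((A l s') f)))
    (h3fin : ∀ i j : ℕ, 1 ≤ i → 1 ≤ j → ∀ s : ℕ, s ≤ k → ∀ s' : ℕ, s' ≤ k → ∀ f : Rp K,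
      (Set.Ici 1 ∩ Function.support fun l : ℕ =>
        (D i j l s') ((A l s) f) + (D i j l s) ((A l s') f)).Finite) :
    ∀ i j : ℕ, 1 ≤ i → 1 ≤ j →
      (∀ F : ℕ → Rp K, (Function.support F).Finite →
        ⁅Lgen K k u A i, Lgen K k u A j⁆ F =
          tshift K (∑ᶠ l ∈ Set.Ici (1 : ℕ),
            (liftE K (∑ s ∈ Finset.range (k + 1), esymK K k u (k - s) • D i j l s))
              ((Lgen K k u A l) F))) ∧
      (∀ F : ℕ → Rp K, (Function.support F).Finite →
        (Set.Ici 1 ∩ Function.support fun l : ℕ =>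
          (liftE K (∑ s ∈ Finset.range (k + 1), esymK K k u (k - s) • D i j l s))
            ((Lgen K k u A l) F)).Finite) := by
  intro i j hi hj
  set B : ℕ → Module.End K (Rp K) := fun i =>
    ∑ s ∈ Finset.range (k + 1), esymK K k u (k - s) • A i s with hB
  set E : ℕ → Module.End K (Rp K) := fun l =>
    ∑ s ∈ Finset.range (k + 1), esymK K k u (k - s) • D i j l s
  have le_of_mem : ∀ s ∈ Finset.range (k + 1), s ≤ k := fun s hs =>
    Nat.lt_succ_iff.mp (Finset.mem_range.mp hs)
  have hp : ∀ f, FinSumsTo (Set.Ici 1) (fun l => E l (pstar K l f))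
      ((⁅pstar K i, B j⁆ - ⁅pstar K j, B i⁆) f) := fun f =>
    finSumsTo_weighted_comp _ _ _ _ _ _ _ _ f fun s hs =>
      ⟨h1fin i j hi hj s (le_of_mem s hs) f, (h1 i j hi hj s (le_of_mem s hs) f).symm⟩
  have hA : ∀ f, FinSumsTo (Set.Ici 1) (fun l => E l (B l f)) (⁅B i, B j⁆ f) := fun f =>
    finSumsTo_weighted_comp_weighted _ _ A _ _ _ f fun s hs r hr =>
      ⟨h3fin i j hi hj s (le_of_mem s hs) r (le_of_mem r hr) f,
        (h3 i j hi hj s (le_of_mem s hs) r (le_of_mem r hr) f).symm⟩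
  have hL : ∀ (l : ℕ) (F : ℕ → Rp K),
      Lgen K k u A l F = -liftE K (pstar K l) F + liftE K (B l) (tshift K F) := by
    intro l F
    rw [← tshift_liftE]
    funext n
    simp [Lgen, liftE_apply, hB]
  have key : ∀ F : ℕ → Rp K, (Function.support F).Finite →
      FinSumsTo (Set.Ici 1) (fun l => liftE K (E l) (Lgen K k u A l F))
        (-liftE K (⁅pstar K i, B j⁆ - ⁅pstar K j, B i⁆) F
          + liftE K ⁅B i, B j⁆ (tshift K F)) := by
    intro F hF
    have ht : (Function.support (tshift K F)).Finite := by
      refine (hF.image Nat.succ).subset fun n hn => ?_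
      cases n with
      | zero => exact absurd rfl hn
      | succ n => exact ⟨n, hn, rfl⟩
    refine FinSumsTo.pi (hF.union ht).toFinset (fun n hn => ?_) fun n => ?_
    · have hn' : F n = 0 ∧ tshift K F n = 0 := by simpa using hn
      simp [hL, liftE_apply, hn'.1, hn'.2]
    · convert ((hp (F n)).smul (-1 : K)).add (hA (tshift K F n)) using 1
      · funext l
        simp [hL, liftE_apply]
      · simp [liftE_apply]
  refine ⟨fun F hF => ?_, fun F hF => (key F hF).1⟩
  rw [(key F hF).2]
  simp only [Ring.lie_def, LinearMap.sub_apply, Module.End.mul_apply, hL]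
  funext n
  cases n with
  | zero => simp [liftE_apply, tshift_apply_zero, pstar_comm K i j]
  | succ n =>
    have hc := pstar_comm K i j (F (n + 1))
    cases n <;> simp [liftE_apply, tshift_apply_zero, tshift_apply_succ, hc] <;> abel
end
end

section
/- For all integers i, j ≥ 1, the operators of the quadratic b-deformed constellation model satisfy: (1) [A_i(1), A_j(1)] = 0 and [p_i^*, A_j(1)] = 0; (2) [A_i(1), A_j(2)] − [A_j(1), A_i(2)] = (i−j) · A_{i+j−1}(1); (3) [p_i^*, A_j(2)] − [p_j^*, A_i(2)] = (i−j) · p^*_{i+j−1}; (4) [A_i(2), A_j(2)] = (i−j) · A_{i+j−1}(2). In particular, the operators A_i(2) span a shifted half-Virasoro algebra, for every value of the deformation parameter b. -/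
noncomputable section

/-- Multiplication by the variable `p_i` (junk value `0` for `i = 0`). -/
def mulpN (K : Type) [Field K] (i : ℕ) : Module.End K (Rp K) :=
  if h : 0 < i then LinearMap.mulLeft K (MvPolynomial.X (⟨i, h⟩ : ℕ+)) else 0

/-- The current operators: `J_{−k}` is multiplication by `p_k` and `J_k = (1+b)·k·∂/∂p_k`
for `k ≥ 1`, and `J₀ = 0`. -/
def Jop (K : Type) [Field K] (b : K) (m : ℤ) : Module.End K (Rp K) :=
  if 0 < m then ((1 + b) * (m : K)) • pderivN K m.toNat else mulpN K (-m).toNat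


theorem Ring.lie_lie_eq_sub {R : Type*} [Ring R] (x y z : R) :
    ⁅⁅x, y⁆, z⁆ = ⁅x, ⁅y, z⁆⁆ - ⁅y, ⁅x, z⁆⁆ := by
  simp only [Ring.lie_def, mul_sub, sub_mul, mul_assoc]
  abel

theorem Ring.sub_lie_eq {R : Type*} [Ring R] (x y z : R) : ⁅x - y, z⁆ = ⁅x, z⁆ - ⁅y, z⁆ := by
  simp only [Ring.lie_def, mul_sub, sub_mul]
  abel

theorem smul_lie_end {K : Type} [Field K] (t : K) (x y : Module.End K (Rp K)) :
    ⁅t • x, y⁆ = t • ⁅x, y⁆ := by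
  refine LinearMap.ext fun f => ?_
  simp [Ring.lie_def, smul_sub]

theorem lie_smul_end {K : Type} [Field K] (t : K) (x y : Module.End K (Rp K)) :
    ⁅x, t • y⁆ = t • ⁅x, y⁆ := by
  refine LinearMap.ext fun f => ?_
  simp [Ring.lie_def, smul_sub]

theorem Ring.lie_skew_eq {R : Type*} [Ring R] (x y : R) : -⁅y, x⁆ = ⁅x, y⁆ := by
  simp only [Ring.lie_def, neg_sub]

theorem pstar_apply {K : Type} [Field K] {i : ℕ} (hi : 0 < i) (f : Rp K) :
    pstar K i f = (i : K) • MvPolynomial.pderiv (i.toPNat hi) f := by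
  have h : pderivN K i = (MvPolynomial.pderiv (i.toPNat hi)).toLinearMap := dif_pos hi
  rw [pstar, h]
  rfl

theorem mulpN_apply {K : Type} [Field K] {i : ℕ} (hi : 0 < i) (f : Rp K) :
    mulpN K i f = MvPolynomial.X (i.toPNat hi) * f := by
  have h : mulpN K i = LinearMap.mulLeft K (MvPolynomial.X (i.toPNat hi)) := dif_pos hi
  rw [h]
  rfl

theorem LinearMap.eq_zero_of_commute_mulpN {K : Type} [Field K] {T : Module.End K (Rp K)}
    (h1 : T 1 = 0) (hT : ∀ n : ℕ, 0 < n → ⁅T, mulpN K n⁆ = 0) : T = 0 := by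
  refine LinearMap.ext fun f => ?_
  induction f using MvPolynomial.induction_on with
  | C a =>
    rw [← mul_one (MvPolynomial.C a), ← MvPolynomial.smul_eq_C_mul, map_smul, h1]
    simp
  | add p q hp hq => rw [map_add, hp, hq]; simp
  | mul_X p n hp =>
    have h := LinearMap.congr_fun (hT n n.pos) p
    rw [Ring.lie_def, LinearMap.sub_apply, Module.End.mul_apply, Module.End.mul_apply, hp,
      mulpN_apply n.pos, LinearMap.zero_apply, map_zero, sub_zero] at h
    rw [mul_comm]
    exact h

theorem lie_pstar_mulpN {K : Type} [Field K] (m n : ℕ) :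
    ⁅pstar K m, mulpN K n⁆ = if m = n then (m : K) • (1 : Module.End K (Rp K)) else 0 := by
  rcases Nat.eq_zero_or_pos m with rfl | hm
  · simp [pstar, Ring.lie_def]
  rcases Nat.eq_zero_or_pos n with rfl | hn
  · simp [mulpN, hm.ne', Ring.lie_def]
  refine LinearMap.ext fun f => ?_
  rw [Ring.lie_def, LinearMap.sub_apply, Module.End.mul_apply, Module.End.mul_apply,
    pstar_apply hm, pstar_apply hm, mulpN_apply hn, mulpN_apply hn, Derivation.leibniz,
    MvPolynomial.pderiv_X]
  by_cases h : m = n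
  · subst h; simp
  · have : n.toPNat hn ≠ m.toPNat hm := fun e => h (congrArg PNat.val e).symm
    simp [h, this]

theorem lie_mulpN_mulpN {K : Type} [Field K] (m n : ℕ) : ⁅mulpN K m, mulpN K n⁆ = 0 := by
  refine LinearMap.ext fun f => ?_
  simp only [mulpN]
  split_ifs <;> simp [Ring.lie_def, mul_left_comm]

theorem pstar_apply_one {K : Type} [Field K] (m : ℕ) : pstar K m 1 = 0 := by
  rcases Nat.eq_zero_or_pos m with rfl | hm
  · simp [pstar]
  · simp [pstar_apply hm]

theorem lie_pstar_pstar {K : Type} [Field K] (m n : ℕ) : ⁅pstar K m, pstar K n⁆ = 0 := by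
  refine LinearMap.eq_zero_of_commute_mulpN ?_ fun l _ => ?_
  · simp [Ring.lie_def, pstar_apply_one]
  · rw [Ring.lie_lie_eq_sub, lie_pstar_mulpN, lie_pstar_mulpN]
    split_ifs <;> simp [Ring.lie_def]

theorem Jop_neg_natCast {K : Type} [Field K] (b : K) (n : ℕ) : Jop K b (-(n : ℤ)) = mulpN K n := by
  simp [Jop]

theorem Jop_natCast {K : Type} [Field K] (b : K) (n : ℕ) :
    Jop K b (n : ℤ) = (1 + b) • pstar K n := by
  rcases Nat.eq_zero_or_pos n with rfl | hn
  · simp [Jop, pstar, mulpN]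
  · simp [Jop, hn, pstar, smul_smul]

theorem lie_Jop_mulpN {K : Type} [Field K] (b : K) (z : ℤ) (n : ℕ) :
    ⁅Jop K b z, mulpN K n⁆ =
      if z = n then ((1 + b) * n) • (1 : Module.End K (Rp K)) else 0 := by
  obtain ⟨m, rfl | rfl⟩ := z.eq_nat_or_neg
  · rw [Jop_natCast, smul_lie_end, lie_pstar_mulpN]
    simp only [Nat.cast_inj]
    split_ifs with h
    · rw [smul_smul, h]
    · simp
  · rw [Jop_neg_natCast, lie_mulpN_mulpN]
    split_ifs with h
    · obtain rfl : n = 0 := by omega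
      simp
    · rfl

/-- The value, up to the factor `n`, of the commutator of `A_{k+1}(2)` with multiplication by `p_n`
when `r = k - n` and `c = b k`. -/
def shiftedCurrent (K : Type) [Field K] (b c : K) (r : ℤ) : Module.End K (Rp K) :=
  if 0 < r then (2 * (1 + b)) • pstar K r.toNat
  else if r = 0 then c • 1 else mulpN K (-r).toNat

theorem shiftedCurrent_natCast {K : Type} [Field K] (b c : K) {n : ℕ} (hn : 0 < n) :
    shiftedCurrent K b c n = (2 * (1 + b)) • pstar K n := by
  simp [shiftedCurrent, hn]

theorem shiftedCurrent_zero {K : Type} [Field K] (b c : K) : shiftedCurrent K b c 0 = c • 1 := by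
  simp [shiftedCurrent]

theorem shiftedCurrent_neg_natCast {K : Type} [Field K] (b c : K) {n : ℕ} (hn : 0 < n) :
    shiftedCurrent K b c (-n) = mulpN K n := by
  simp [shiftedCurrent, hn.ne']

theorem shiftedCurrent_congr {K : Type} [Field K] (b c d : K) {r : ℤ} (hr : r ≠ 0) :
    shiftedCurrent K b c r = shiftedCurrent K b d r := by
  simp [shiftedCurrent, hr]

theorem lie_pstar_of_lie_mulpN {K : Type} [Field K] {b c : K} {T : Module.End K (Rp K)} {k : ℕ}
    (h1 : T 1 = 0)
    (hT : ∀ n : ℕ, 0 < n → ⁅T, mulpN K n⁆ = (n : K) • shiftedCurrent K b c ((k : ℤ) - n)) (r : ℕ) :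
    ⁅T, pstar K r⁆ = -(r : K) • pstar K (k + r) := by
  rw [← sub_eq_zero]
  refine LinearMap.eq_zero_of_commute_mulpN ?_ fun n hn => ?_
  · simp [Ring.lie_def, pstar_apply_one, h1]
  rw [Ring.sub_lie_eq, Ring.lie_lie_eq_sub, lie_pstar_mulpN, hT n hn, smul_lie_end, lie_pstar_mulpN, lie_smul_end]
  have hs : ⁅T, if r = n then (r : K) • (1 : Module.End K (Rp K)) else 0⁆ = 0 := by
    split_ifs <;> simp [Ring.lie_def]
  rw [hs]
  rcases lt_trichotomy n k with h | rfl | h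
  · obtain ⟨d, rfl⟩ := Nat.exists_eq_add_of_lt h
    rw [show ((n + d + 1 : ℕ) : ℤ) - n = (d + 1 : ℕ) by push_cast; ring,
      shiftedCurrent_natCast _ _ d.succ_pos, lie_smul_end, lie_pstar_pstar, if_neg (by omega)]
    simp
  · rw [sub_self, shiftedCurrent_zero]
    rcases Nat.eq_zero_or_pos r with rfl | hr
    · simp [Ring.lie_def]
    · rw [if_neg (by omega)]
      simp [Ring.lie_def]
  · obtain ⟨d, rfl⟩ := Nat.exists_eq_add_of_lt h
    rw [show (k : ℤ) - (k + d + 1 : ℕ) = -(d + 1 : ℕ) by push_cast; ring,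
      shiftedCurrent_neg_natCast _ _ d.succ_pos, lie_pstar_mulpN]
    by_cases hr : r = d + 1
    · subst hr
      simp only [if_true, add_assoc, smul_smul]
      push_cast
      module
    · rw [if_neg hr, if_neg (by omega)]
      simp

theorem lie_shiftedCurrent_of_lie_mulpN {K : Type} [Field K] {b c : K}
    {T : Module.End K (Rp K)} {k : ℕ} (h1 : T 1 = 0)
    (hT : ∀ n : ℕ, 0 < n → ⁅T, mulpN K n⁆ = (n : K) • shiftedCurrent K b c ((k : ℤ) - n))
    (d : K) (r : ℤ) :
    ⁅T, shiftedCurrent K b d r⁆ = -(r : K) • shiftedCurrent K b c (k + r) := by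
  obtain ⟨m, rfl | rfl⟩ := r.eq_nat_or_neg <;> rcases Nat.eq_zero_or_pos m with rfl | hm
  · simp [shiftedCurrent_zero, Ring.lie_def]
  · rw [shiftedCurrent_natCast _ _ hm, lie_smul_end, lie_pstar_of_lie_mulpN h1 hT, ← Nat.cast_add,
      shiftedCurrent_natCast _ _ (by omega), Int.cast_natCast]
    module
  · simp [shiftedCurrent_zero, Ring.lie_def]
  · rw [shiftedCurrent_neg_natCast _ _ hm, hT m hm, ← sub_eq_add_neg]
    simp

theorem lie_eq_of_lie_mulpN {K : Type} [Field K] {b : K} {L : ℕ → Module.End K (Rp K)}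
    (h1 : ∀ k, L k 1 = 0)
    (hL : ∀ k n : ℕ, 0 < n →
      ⁅L k, mulpN K n⁆ = (n : K) • shiftedCurrent K b (b * k) ((k : ℤ) - n)) (k l : ℕ) :
    ⁅L k, L l⁆ = ((k : K) - (l : K)) • L (k + l) := by
  rw [← sub_eq_zero]
  refine LinearMap.eq_zero_of_commute_mulpN ?_ fun n hn => ?_
  · simp [Ring.lie_def, h1]
  rw [Ring.sub_lie_eq, Ring.lie_lie_eq_sub, smul_lie_end, hL k n hn, hL l n hn, hL (k + l) n hn, lie_smul_end, lie_smul_end,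
    lie_shiftedCurrent_of_lie_mulpN (h1 k) (hL k), lie_shiftedCurrent_of_lie_mulpN (h1 l) (hL l),
    show (l : ℤ) + (k - n) = k + l - n by ring, show (k : ℤ) + (l - n) = k + l - n by ring]
  push_cast
  by_cases h : (k : ℤ) + l - n = 0
  · have hn' : (n : K) = k + l := by
      rw [← Nat.cast_add, show n = k + l by omega]
    rw [h, shiftedCurrent_zero, shiftedCurrent_zero, shiftedCurrent_zero, hn']
    module
  · rw [shiftedCurrent_congr b (b * l) (b * k) h,
      shiftedCurrent_congr b (b * (k + l)) (b * k) h]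
    module

theorem constellation_one {K : Type} [Field K] {b : K} (hb : (1 : K) + b ≠ 0)
    {A : ℕ → ℕ → Module.End K (Rp K)}
    (hbase1 : A 1 0 = ((1 : K) + b)⁻¹ • (1 : Module.End K (Rp K)))
    (hbase : ∀ i : ℕ, i ≠ 1 → A i 0 = 0)
    (hrec : ∀ i : ℕ, 1 ≤ i → ∀ f : Rp K,
      (A i 1) f =
        (∑ᶠ n ∈ Set.Ici (1 : ℕ), (Jop K b ((i : ℤ) - (n : ℤ))) ((A n 0) f)) +
          (b * ((i : K) - 1)) • (A i 0) f) (k : ℕ) :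
    A (k + 1) 1 = pstar K k := by
  refine LinearMap.ext fun f => ?_
  rw [hrec _ (by omega) f, finsum_mem_eq_sum_of_subset (t := {1})]
  · have : (b * (((k + 1 : ℕ) : K) - 1)) • (A (k + 1) 0) f = 0 := by
      rcases Nat.eq_zero_or_pos k with rfl | hk
      · simp
      · simp [hbase (k + 1) (by omega)]
    rw [this, Finset.sum_singleton, hbase1,
      show ((k + 1 : ℕ) : ℤ) - (1 : ℕ) = k by push_cast; ring, Jop_natCast]
    simp [smul_smul, hb]
  · intro n hn
    by_contra h
    exact hn.2 (by simp [hbase n (by simpa using h)])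
  · simp

theorem lie_Jop_mul_pstar_mulpN {K : Type} [Field K] (b : K) (z : ℤ) (m n : ℕ) :
    ⁅Jop K b z * pstar K m, mulpN K n⁆ =
      (if m = n then (n : K) • Jop K b z else 0) +
        if z = n then ((1 + b) * n) • pstar K m else 0 := by
  have key : ⁅Jop K b z * pstar K m, mulpN K n⁆ =
      Jop K b z * ⁅pstar K m, mulpN K n⁆ + ⁅Jop K b z, mulpN K n⁆ * pstar K m := by
    simp only [Ring.lie_def]
    rw [mul_sub, sub_mul, mul_assoc, mul_assoc, mul_assoc]
    abel
  rw [key, lie_pstar_mulpN, lie_Jop_mulpN]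
  congr 1
  · split_ifs with h
    · simp [h]
    · simp
  · split_ifs <;> simp

theorem constellation_two_lie_mulpN {K : Type} [Field K] {b : K}
    {T : Module.End K (Rp K)} {k : ℕ}
    (hfin : ∀ f : Rp K, (Function.support fun m : ℕ =>
      (Jop K b ((k : ℤ) - m) * pstar K m) f).Finite)
    (hT : ∀ f : Rp K, T f =
      (∑ᶠ m : ℕ, (Jop K b ((k : ℤ) - m) * pstar K m) f) + (b * k) • pstar K k f)
    {n : ℕ} (hn : 0 < n) :
    ⁅T, mulpN K n⁆ = (n : K) • shiftedCurrent K b (b * k) ((k : ℤ) - n) := by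
  refine LinearMap.ext fun f => ?_
  let S : Finset ℕ :=
    (hfin f).toFinset ∪ (hfin (mulpN K n f)).toFinset ∪ {n, k - n}
  have hsum : (∑ᶠ m : ℕ, (Jop K b ((k : ℤ) - m) * pstar K m) (mulpN K n f)) -
      mulpN K n (∑ᶠ m : ℕ, (Jop K b ((k : ℤ) - m) * pstar K m) f) =
      (n : K) • Jop K b ((k : ℤ) - n) f +
        if n ≤ k then ((1 + b) * n) • pstar K (k - n) f else 0 := by
    rw [finsum_eq_sum_of_support_subset (s := S), finsum_eq_sum_of_support_subset (s := S),
      map_sum, ← Finset.sum_sub_distrib]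
    · have hterm : ∀ m ∈ S, (Jop K b ((k : ℤ) - m) * pstar K m) (mulpN K n f) -
          mulpN K n ((Jop K b ((k : ℤ) - m) * pstar K m) f) =
          (if m = n then (n : K) • Jop K b ((k : ℤ) - n) f else 0) +
            if m = k - n then
              (if n ≤ k then ((1 + b) * n) • pstar K (k - n) f else 0) else 0 := by
        intro m _
        have h := LinearMap.congr_fun (lie_Jop_mul_pstar_mulpN b ((k : ℤ) - m) m n) f
        rw [Ring.lie_def, LinearMap.sub_apply, LinearMap.add_apply] at h
        refine Eq.trans h ?_
        congr 1
        · split_ifs with e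
          · subst e; rfl
          · rfl
        · split_ifs with e1 e2 e3 e3 e4
          · subst e2; rfl
          · omega
          · omega
          · obtain rfl : m = 0 := by omega
            omega
          · rfl
          · rfl
      rw [Finset.sum_congr rfl hterm, Finset.sum_add_distrib, Finset.sum_ite_eq',
        Finset.sum_ite_eq', if_pos (by simp [S]), if_pos (by simp [S])]
    · intro m hm
      simp only [S, Finset.coe_union, Set.Finite.coe_toFinset]
      exact Or.inl (Or.inl hm)
    · intro m hm
      simp only [S, Finset.coe_union, Set.Finite.coe_toFinset]
      exact Or.inl (Or.inr hm)
  have hlast : pstar K k (mulpN K n f) - mulpN K n (pstar K k f) =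
      if k = n then (k : K) • f else 0 := by
    have h := LinearMap.congr_fun (lie_pstar_mulpN (K := K) k n) f
    rw [Ring.lie_def, LinearMap.sub_apply] at h
    refine Eq.trans h ?_
    split_ifs <;> rfl
  have hmain : ⁅T, mulpN K n⁆ f = ((n : K) • Jop K b ((k : ℤ) - n) f +
      if n ≤ k then ((1 + b) * n) • pstar K (k - n) f else 0) +
      (b * k) • if k = n then (k : K) • f else 0 := by
    rw [← hsum, ← hlast, Ring.lie_def, LinearMap.sub_apply, Module.End.mul_apply,
      Module.End.mul_apply, hT, hT, map_add, map_smul]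
    module
  rw [hmain]
  rcases lt_trichotomy n k with h | rfl | h
  · obtain ⟨d, rfl⟩ := Nat.exists_eq_add_of_lt h
    rw [show ((n + d + 1 : ℕ) : ℤ) - n = (d + 1 : ℕ) by push_cast; ring,
      shiftedCurrent_natCast _ _ d.succ_pos, Jop_natCast, if_pos (by omega), if_neg (by omega),
      show n + d + 1 - n = d + 1 by omega]
    simp only [LinearMap.smul_apply]
    module
  · rw [sub_self, shiftedCurrent_zero]
    simp [Jop, mulpN, pstar, smul_smul, mul_comm]
  · obtain ⟨d, rfl⟩ := Nat.exists_eq_add_of_lt h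
    rw [show (k : ℤ) - (k + d + 1 : ℕ) = -(d + 1 : ℕ) by push_cast; ring,
      shiftedCurrent_neg_natCast _ _ d.succ_pos, Jop_neg_natCast, if_neg (by omega),
      if_neg (by omega)]
    simp

/--
**Commutation relations for the quadratic `b`-deformed constellation operators.**
Given the operators `A_i(s)` on `R = K[p₁, p₂, …]` determined by `A₁(0) = (1+b)⁻¹·id`,
`A_i(0) = 0` for `i ≠ 1`, and the (locally finite) recursion
`A_i(s+1) = Σ_{n≥1} J_{i−n} ∘ A_n(s) + b(i−1)·A_i(s)`,
one has, for all `i, j ≥ 1`: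
(1) `[A_i(1), A_j(1)] = 0` and `[p_i^*, A_j(1)] = 0`;
(2) `[A_i(1), A_j(2)] − [A_j(1), A_i(2)] = (i−j)·A_{i+j−1}(1)`;
(3) `[p_i^*, A_j(2)] − [p_j^*, A_i(2)] = (i−j)·p^*_{i+j−1}`;
(4) `[A_i(2), A_j(2)] = (i−j)·A_{i+j−1}(2)`.
In particular the operators `A_i(2)` span a shifted half-Virasoro algebra, for every value of
the deformation parameter `b`.
-/
theorem stmt_9 {K : Type} [Field K] [CharZero K] (b : K) (hb : (1 : K) + b ≠ 0)
    (A : ℕ → ℕ → Module.End K (Rp K))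
    (hbase1 : A 1 0 = ((1 : K) + b)⁻¹ • (1 : Module.End K (Rp K)))
    (hbase : ∀ i : ℕ, i ≠ 1 → A i 0 = 0)
    (hfin : ∀ (i s : ℕ) (f : Rp K),
      (Set.Ici 1 ∩ Function.support fun n : ℕ =>
        (Jop K b ((i : ℤ) - (n : ℤ))) ((A n s) f)).Finite)
    (hrec : ∀ i : ℕ, 1 ≤ i → ∀ (s : ℕ) (f : Rp K),
      (A i (s + 1)) f =
        (∑ᶠ n ∈ Set.Ici (1 : ℕ), (Jop K b ((i : ℤ) - (n : ℤ))) ((A n s) f)) +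
          (b * ((i : K) - 1)) • (A i s) f) :
    ∀ i j : ℕ, 1 ≤ i → 1 ≤ j →
      (⁅A i 1, A j 1⁆ = 0 ∧ ⁅pstar K i, A j 1⁆ = 0) ∧
      ⁅A i 1, A j 2⁆ - ⁅A j 1, A i 2⁆ = ((i : K) - (j : K)) • A (i + j - 1) 1 ∧
      ⁅pstar K i, A j 2⁆ - ⁅pstar K j, A i 2⁆ = ((i : K) - (j : K)) • pstar K (i + j - 1) ∧
      ⁅A i 2, A j 2⁆ = ((i : K) - (j : K)) • A (i + j - 1) 2 := by
  have hA1 := constellation_one hb hbase1 hbase fun i hi f => hrec i hi 0 f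
  have hshift : ∀ (k : ℕ) (f : Rp K),
      (fun m : ℕ => Jop K b (((k + 1 : ℕ) : ℤ) - ((m + 1 : ℕ) : ℤ)) (A (m + 1) 1 f)) =
        fun m : ℕ => (Jop K b ((k : ℤ) - m) * pstar K m) f := by
    intro k f
    ext1 m
    rw [hA1, Module.End.mul_apply]
    rw [show ((k + 1 : ℕ) : ℤ) - ((m + 1 : ℕ) : ℤ) = k - m by push_cast; ring]
  have hfin2 : ∀ (k : ℕ) (f : Rp K), (Function.support fun m : ℕ =>
      (Jop K b ((k : ℤ) - m) * pstar K m) f).Finite := by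
    intro k f
    rw [← hshift]
    refine ((hfin (k + 1) 1 f).preimage (f := fun m => m + 1)
      (add_left_injective 1).injOn).subset fun m hm => ?_
    exact ⟨Nat.succ_pos m, hm⟩
  have hT : ∀ (k : ℕ) (f : Rp K), A (k + 1) 2 f =
      (∑ᶠ m : ℕ, (Jop K b ((k : ℤ) - m) * pstar K m) f) + (b * k) • pstar K k f := by
    intro k f
    have hrange : Set.Ici (1 : ℕ) = Set.range fun m : ℕ => m + 1 := by
      ext n
      simp only [Set.mem_Ici, Set.mem_range]
      exact ⟨fun h => ⟨n - 1, by omega⟩, fun ⟨m, hm⟩ => by omega⟩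
    rw [hrec _ (by omega) 1 f, hrange, finsum_mem_range (add_left_injective 1), hshift, hA1]
    simp
  have hL := fun k n : ℕ => constellation_two_lie_mulpN (n := n) (hfin2 k) (hT k)
  have h1 : ∀ k : ℕ, A (k + 1) 2 1 = 0 := by
    intro k
    rw [hT]
    simp [pstar_apply_one]
  have hP : ∀ k r : ℕ, ⁅pstar K r, A (k + 1) 2⁆ = (r : K) • pstar K (k + r) := by
    intro k r
    rw [← Ring.lie_skew_eq, lie_pstar_of_lie_mulpN (h1 k) (hL k)]
    module
  intro i j hi hj
  obtain ⟨k, rfl⟩ := Nat.exists_eq_add_of_le' hi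
  obtain ⟨l, rfl⟩ := Nat.exists_eq_add_of_le' hj
  rw [show k + 1 + (l + 1) - 1 = k + l + 1 by omega]
  refine ⟨⟨?_, ?_⟩, ?_, ?_, ?_⟩
  · rw [hA1, hA1, lie_pstar_pstar]
  · rw [hA1, lie_pstar_pstar]
  · rw [hA1, hA1, hA1, hP, hP, add_comm l k]
    push_cast
    module
  · rw [hP, hP, show l + (k + 1) = k + l + 1 by omega, show k + (l + 1) = k + l + 1 by omega]
    module
  · rw [lie_eq_of_lie_mulpN (L := fun k => A (k + 1) 2) h1 hL]
    push_cast
    module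
end
end
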